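/- Let q ≥ 1 with Hölder conjugate p (1/p + 1/q = 1, with p = ∞ when q = 1), let R_1,…,R_n ∈ ℝ^d, let φ ∈ ℝ^d and δ ≥ 0. Then the infimum of E_P[⟨φ,R⟩] over all Borel probability measures P on ℝ^d with finite first moment satisfying D_c(P,P_n) ≤ δ equals E_{P_n}[⟨φ,R⟩] − √δ · ‖φ‖_p, i.e. min_{P : D_c(P,P_n) ≤ δ} E_P[⟨φ,R⟩] = (1/n) Σ_{i=1}^n ⟨φ,R_i⟩ − √δ ‖φ‖_p. -/

import Mathlib

open MeasureTheory ENNReal NNReal Filter Topology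

noncomputable section

/-- The `l_p` norm on `ℝ^d`, for an extended exponent `p` (sup-norm when `p = ∞`). -/
def lpNorm {d : ℕ} (p : ℝ≥0∞) (x : Fin d → ℝ) : ℝ :=
  if p = ∞ then ⨆ i, |x i| else (∑ i, |x i| ^ p.toReal) ^ (1 / p.toReal)

/-- `p ∈ [1,∞]` is the Hölder conjugate of `q ∈ [1,∞)`: `1/p + 1/q = 1`,
with `p = ∞` when `q = 1`. -/
def HolderConjugate (q : ℝ) (p : ℝ≥0∞) : Prop :=
  (q = 1 ∧ p = ∞) ∨ (1 < q ∧ p ≠ ∞ ∧ 1 / p.toReal + 1 / q = 1)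

/-- The optimal transport discrepancy between two Borel probability measures on `ℝ^d`
associated with a cost function `c`. -/
def Dc {d : ℕ} (c : (Fin d → ℝ) → (Fin d → ℝ) → ℝ≥0∞)
    (P Q : Measure (Fin d → ℝ)) : ℝ≥0∞ :=
  ⨅ (π : Measure ((Fin d → ℝ) × (Fin d → ℝ))) (_ : IsProbabilityMeasure π)
    (_ : π.map Prod.fst = P) (_ : π.map Prod.snd = Q), ∫⁻ x, c x.1 x.2 ∂π

/-- The quadratic `l_q` transport cost `c(u,w) = ‖u - w‖_q²`. -/
def costQ {d : ℕ} (q : ℝ) (u w : Fin d → ℝ) : ℝ≥0∞ :=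
  ENNReal.ofReal (lpNorm (ENNReal.ofReal q) (u - w) ^ 2)

/-- The empirical measure `P_n = (1/n) ∑_{i=1}^n δ_{R_i}`. -/
def empMeasure {d n : ℕ} (R : Fin n → Fin d → ℝ) : Measure (Fin d → ℝ) :=
  (n : ℝ≥0∞)⁻¹ • ∑ i : Fin n, Measure.dirac (R i)

/-- Weak convergence of a sequence of measures, expressed via integration of
bounded continuous functions. -/
def WeakConv {E : Type*} [TopologicalSpace E] [MeasurableSpace E]
    (μs : ℕ → Measure E) (ν : Measure E) : Prop :=
  ∀ f : BoundedContinuousFunction E ℝ,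
    Tendsto (fun n => ∫ x, f x ∂(μs n)) atTop (𝓝 (∫ x, f x ∂ν))

/-- The `l_q` norm at a finite exponent `q ≥ 1`, as a power sum. -/
theorem lpNorm_ofReal {d : ℕ} {q : ℝ} (hq : 1 ≤ q) (x : Fin d → ℝ) :
    _root_.lpNorm (ENNReal.ofReal q) x = (∑ i, |x i| ^ q) ^ (1 / q) := by
  simp [_root_.lpNorm, ENNReal.toReal_ofReal (zero_le_one.trans hq)]

theorem lpNorm_exponent_nonneg {d : ℕ} (p : ℝ≥0∞) (x : Fin d → ℝ) : 0 ≤ _root_.lpNorm p x := by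
  unfold _root_.lpNorm
  split_ifs
  · exact Real.iSup_nonneg fun i => abs_nonneg _
  · positivity

theorem measurable_lpNorm_ofReal {d : ℕ} {q : ℝ} (hq : 1 ≤ q) :
    Measurable fun x : Fin d → ℝ => _root_.lpNorm (ENNReal.ofReal q) x := by
  simp only [lpNorm_ofReal hq]
  fun_prop

theorem lpNorm_ofReal_smul {d : ℕ} {q : ℝ} (hq : 1 ≤ q) (a : ℝ) (x : Fin d → ℝ) :
    _root_.lpNorm (ENNReal.ofReal q) (a • x) = |a| * _root_.lpNorm (ENNReal.ofReal q) x := by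
  have hq0 : q ≠ 0 := by linarith
  simp only [lpNorm_ofReal hq, Pi.smul_apply, smul_eq_mul, abs_mul,
    Real.mul_rpow (abs_nonneg _) (abs_nonneg _), ← Finset.mul_sum]
  rw [Real.mul_rpow (by positivity) (by positivity), ← Real.rpow_mul (abs_nonneg _),
    mul_one_div_cancel hq0, Real.rpow_one]

theorem toReal_holderConjugate {q : ℝ} {p : ℝ≥0∞} (hq : 1 < q)
    (h : 1 / p.toReal + 1 / q = 1) : p.toReal.HolderConjugate q := by
  refine Real.HolderConjugate.symm ?_
  rw [Real.holderConjugate_iff]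
  refine ⟨hq, ?_⟩
  rw [← h]
  simp [add_comm]

/-- Hölder's inequality for the pairing `∑ φ i * x i`. -/
theorem abs_sum_mul_le_lpNorm_mul_lpNorm {d : ℕ} {q : ℝ} {p : ℝ≥0∞} (hq : 1 ≤ q)
    (hpq : _root_.HolderConjugate q p) (φ x : Fin d → ℝ) :
    |∑ i, φ i * x i| ≤ _root_.lpNorm p φ * _root_.lpNorm (ENNReal.ofReal q) x := by
  rw [lpNorm_ofReal hq]
  rcases hpq with ⟨rfl, rfl⟩ | ⟨hq1, hp, h⟩
  · simp only [_root_.lpNorm, if_true, Real.rpow_one, div_one, Finset.mul_sum]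
    refine (Finset.abs_sum_le_sum_abs _ _).trans (Finset.sum_le_sum fun i _ => ?_)
    rw [abs_mul]
    exact mul_le_mul_of_nonneg_right
      (le_ciSup (f := fun i => |φ i|) (Set.finite_range _).bddAbove i) (abs_nonneg _)
  · rw [_root_.lpNorm, if_neg hp, abs_le']
    have hc := toReal_holderConjugate hq1 h
    refine ⟨Real.inner_le_Lp_mul_Lq _ φ x hc, ?_⟩
    simpa using Real.inner_le_Lp_mul_Lq Finset.univ (fun i => - φ i) x hc

/-- The dual norm is attained at some point of the closed `l_q` unit ball. -/
theorem exists_lpNorm_le_one_sum_mul_eq {d : ℕ} {q : ℝ} {p : ℝ≥0∞} (hq : 1 ≤ q)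
    (hpq : _root_.HolderConjugate q p) (φ : Fin d → ℝ) :
    ∃ v : Fin d → ℝ, _root_.lpNorm (ENNReal.ofReal q) v ≤ 1 ∧
      ∑ i, φ i * v i = _root_.lpNorm p φ := by
  simp only [lpNorm_ofReal hq]
  rcases hpq with ⟨rfl, rfl⟩ | ⟨hq1, hp, h⟩
  · simp only [_root_.lpNorm, if_true, Real.rpow_one, div_one]
    rcases isEmpty_or_nonempty (Fin d) with hd | hd
    · exact ⟨0, by simp, by simp⟩
    · obtain ⟨j, hj⟩ := exists_eq_ciSup_of_finite (f := fun i => |φ i|)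
      refine ⟨Pi.single j (SignType.sign (φ j) : ℝ), ?_, ?_⟩
      · rw [Finset.sum_eq_single j (by intro i _ hi; simp [hi]) (by simp)]
        rcases lt_trichotomy (φ j) 0 with h | h | h <;> simp [h]
      · rw [Finset.sum_eq_single j (by intro i _ hi; simp [hi]) (by simp), ← hj]
        simp [mul_comm (φ j), sign_mul_self]
  · have hc := toReal_holderConjugate hq1 h
    obtain ⟨g, hg, hgs⟩ := (NNReal.isGreatest_Lp Finset.univ (fun i => ‖φ i‖₊) hc).1
    have hg' : ∑ i, (g i : ℝ) ^ q ≤ 1 := by exact_mod_cast hg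
    have hgs' : ∑ i, |φ i| * (g i : ℝ) = (∑ i, |φ i| ^ p.toReal) ^ (1 / p.toReal) := by
      have := congrArg NNReal.toReal hgs
      push_cast at this
      simpa using this
    refine ⟨fun i => (SignType.sign (φ i) : ℝ) * g i, ?_, ?_⟩
    · refine Real.rpow_le_one (by positivity) (le_trans ?_ hg') (by positivity)
      refine Finset.sum_le_sum fun i _ =>
        Real.rpow_le_rpow (abs_nonneg _) ?_ (by linarith)
      rcases lt_trichotomy (φ i) 0 with h | h | h <;> simp [h]
    · rw [_root_.lpNorm, if_neg hp, ← hgs']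
      refine Finset.sum_congr rfl fun i _ => ?_
      rw [← mul_assoc, mul_comm (φ i), sign_mul_self]

theorem isProbabilityMeasure_empMeasure {d n : ℕ} (hn : 0 < n) (R : Fin n → Fin d → ℝ) :
    IsProbabilityMeasure (empMeasure R) := by
  constructor
  simp [empMeasure, ENNReal.inv_mul_cancel, hn.ne']

theorem integrable_empMeasure {d n : ℕ} (hn : 0 < n) (R : Fin n → Fin d → ℝ)
    (f : (Fin d → ℝ) → ℝ) : Integrable f (empMeasure R) := by
  refine Integrable.smul_measure ?_ (by simp [hn.ne'])
  exact integrable_finsetSum_measure.2 fun i _ => integrable_dirac (by simp)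

theorem integral_empMeasure {d n : ℕ} (R : Fin n → Fin d → ℝ) (f : (Fin d → ℝ) → ℝ) :
    ∫ x, f x ∂(empMeasure R) = (1 / n : ℝ) * ∑ i, f (R i) := by
  rw [empMeasure, integral_smul_measure,
    integral_finsetSum_measure fun i _ => integrable_dirac (by simp)]
  simp

/-- A coupling of finite quadratic cost bounds the drop of a linear functional. -/
theorem integral_sub_le_of_coupling {d : ℕ} {q : ℝ} {p : ℝ≥0∞} (hq : 1 ≤ q)
    (hpq : _root_.HolderConjugate q p) (φ : Fin d → ℝ)
    (π : Measure ((Fin d → ℝ) × (Fin d → ℝ))) [IsProbabilityMeasure π]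
    (hfst : Integrable (fun x => ∑ i, φ i * x.1 i) π)
    (hsnd : Integrable (fun x => ∑ i, φ i * x.2 i) π) {s : ℝ} (hs : 0 < s)
    (hcost : ∫⁻ x, costQ q x.1 x.2 ∂π ≤ ENNReal.ofReal s) :
    ∫ x, ∑ i, φ i * x.2 i ∂π - Real.sqrt s * _root_.lpNorm p φ ≤
      ∫ x, ∑ i, φ i * x.1 i ∂π := by
  set N : (Fin d → ℝ) × (Fin d → ℝ) → ℝ :=
    fun x => _root_.lpNorm (ENNReal.ofReal q) (x.1 - x.2) with hN
  have hNm : Measurable fun x => N x ^ 2 :=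
    ((measurable_lpNorm_ofReal hq).comp (measurable_fst.sub measurable_snd)).pow_const 2
  have hcost' : ∫⁻ x, ENNReal.ofReal (N x ^ 2) ∂π ≤ ENNReal.ofReal s := hcost
  have hNint : Integrable (fun x => N x ^ 2) π := by
    refine ⟨hNm.aestronglyMeasurable, ?_⟩
    rw [hasFiniteIntegral_iff_ofReal (.of_forall fun x => sq_nonneg _)]
    exact hcost'.trans_lt ENNReal.ofReal_lt_top
  have hNs : ∫ x, N x ^ 2 ∂π ≤ s := by
    rw [integral_eq_lintegral_of_nonneg_ae (.of_forall fun x => sq_nonneg _)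
      hNm.aestronglyMeasurable]
    exact ENNReal.toReal_le_of_le_ofReal hs.le hcost'
  set t := Real.sqrt s with ht
  have ht0 : 0 < t := Real.sqrt_pos.2 hs
  have hts : t ^ 2 = s := Real.sq_sqrt hs.le
  set L := _root_.lpNorm p φ
  have hL : 0 ≤ L := lpNorm_exponent_nonneg p φ
  have hpoint : ∀ x : (Fin d → ℝ) × (Fin d → ℝ),
      ∑ i, φ i * x.2 i - ∑ i, φ i * x.1 i ≤ L / (2 * t) * N x ^ 2 + L * t / 2 := by
    intro x
    have h1 := (abs_le.1 (abs_sum_mul_le_lpNorm_mul_lpNorm hq hpq φ (x.1 - x.2))).1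
    have h2 : ∑ i, φ i * (x.1 - x.2) i = ∑ i, φ i * x.1 i - ∑ i, φ i * x.2 i := by
      simp [mul_sub, Finset.sum_sub_distrib]
    have h3 : L * N x ≤ L / (2 * t) * N x ^ 2 + L * t / 2 := by
      have : L / (2 * t) * N x ^ 2 + L * t / 2 - L * N x = L * (N x - t) ^ 2 / (2 * t) := by
        field_simp; ring
      have h4 : 0 ≤ L * (N x - t) ^ 2 / (2 * t) := by positivity
      linarith
    rw [h2] at h1
    linarith
  have hmono := integral_mono (hsnd.sub hfst)
    ((hNint.const_mul (L / (2 * t))).add (integrable_const (L * t / 2))) hpoint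
  simp only [Pi.add_apply, Pi.sub_apply] at hmono
  rw [integral_sub hsnd hfst, integral_add (hNint.const_mul _) (integrable_const _),
    integral_const_mul, integral_const] at hmono
  have h5 : L / (2 * t) * ∫ x, N x ^ 2 ∂π ≤ L / (2 * t) * t ^ 2 := by
    rw [hts]; gcongr
  have h6 : L / (2 * t) * t ^ 2 = L * t / 2 := by field_simp
  simp at hmono
  linarith

/-- Worst-case expected return over a Wasserstein ball:
`min_{P : D_c(P,P_n) ≤ δ} E_P[⟨φ,R⟩] = E_{P_n}[⟨φ,R⟩] − √δ ‖φ‖_p`. -/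
theorem stmt0 {d n : ℕ} (hn : 0 < n) (q : ℝ) (hq : 1 ≤ q) (p : ℝ≥0∞)
    (hpq : HolderConjugate q p) (R : Fin n → Fin d → ℝ) (φ : Fin d → ℝ)
    (δ : ℝ) (hδ : 0 ≤ δ) :
    sInf {x : ℝ | ∃ P : Measure (Fin d → ℝ), IsProbabilityMeasure P ∧
        Integrable (fun r => ‖r‖) P ∧
        Dc (costQ q) P (empMeasure R) ≤ ENNReal.ofReal δ ∧
        x = ∫ r, ∑ i, φ i * r i ∂P} =
      (1 / n : ℝ) * (∑ i, ∑ j, φ j * R i j) - Real.sqrt δ * lpNorm p φ := by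
  have hemp := isProbabilityMeasure_empMeasure hn R
  have hlin : Continuous fun r : Fin d → ℝ => ∑ i, φ i * r i := by fun_prop
  refine IsLeast.csInf_eq ⟨?_, ?_⟩
  · obtain ⟨v, hv, hφv⟩ := exists_lpNorm_le_one_sum_mul_eq hq hpq φ
    set T : (Fin d → ℝ) → (Fin d → ℝ) := fun r => r - Real.sqrt δ • v with hT
    have hTm : Measurable T := by fun_prop
    refine ⟨(empMeasure R).map T, Measure.isProbabilityMeasure_map hTm.aemeasurable, ?_, ?_, ?_⟩
    · rw [integrable_map_measure (by fun_prop) hTm.aemeasurable]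
      exact integrable_empMeasure hn R _
    · have hpair : Measurable fun r => (T r, r) := hTm.prodMk measurable_id
      refine (iInf_le_of_le ((empMeasure R).map fun r => (T r, r)) <| iInf_le_of_le
        (Measure.isProbabilityMeasure_map hpair.aemeasurable) <| iInf_le_of_le ?_ <|
        iInf_le_of_le ?_ ?_)
      · rw [Measure.map_map measurable_fst hpair]; rfl
      · rw [Measure.map_map measurable_snd hpair]; exact Measure.map_id
      · refine (lintegral_map_le _ _).trans ?_
        have hle : ∀ r, costQ q (T r) r ≤ ENNReal.ofReal δ := by
          intro r
          have : T r - r = (-Real.sqrt δ) • v := by simp [hT]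
          rw [costQ, this, lpNorm_ofReal_smul hq, abs_neg, abs_of_nonneg (Real.sqrt_nonneg _),
            mul_pow, Real.sq_sqrt hδ]
          refine ENNReal.ofReal_le_ofReal (mul_le_of_le_one_right hδ ?_)
          exact pow_le_one₀ (lpNorm_exponent_nonneg _ _) hv
        refine (lintegral_mono hle).trans ?_
        simp
    · rw [integral_map hTm.aemeasurable hlin.aestronglyMeasurable, integral_empMeasure, ← hφv]
      have hn' : (n : ℝ) ≠ 0 := by exact_mod_cast hn.ne'
      have hshift : ∀ r, ∑ i, φ i * T r i =
          ∑ i, φ i * r i - Real.sqrt δ * ∑ i, φ i * v i := by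
        intro r
        simp [hT, mul_sub, Finset.sum_sub_distrib, Finset.mul_sum, mul_left_comm]
      simp only [hshift, Finset.sum_sub_distrib, Finset.sum_const, Finset.card_univ,
        Fintype.card_fin, nsmul_eq_mul]
      field_simp
  · rintro x ⟨P, hP, hint, hD, rfl⟩
    have hφP : Integrable (fun r => ∑ i, φ i * r i) P := by
      have hid : Integrable (fun r : Fin d → ℝ => r) P :=
        (integrable_norm_iff (by fun_prop)).1 hint
      exact integrable_finsetSum _ fun i _ => (hid.eval i).const_mul _
    have hbound : ∀ s, δ < s →
        (1 / n : ℝ) * (∑ i, ∑ j, φ j * R i j) - Real.sqrt s * _root_.lpNorm p φ ≤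
          ∫ r, ∑ i, φ i * r i ∂P := by
      intro s hs
      have hs0 : 0 < s := hδ.trans_lt hs
      have hlt := hD.trans_lt ((ENNReal.ofReal_lt_ofReal_iff hs0).2 hs)
      simp only [Dc, iInf_lt_iff] at hlt
      obtain ⟨π, hπ, h1, h2, hc⟩ := hlt
      have i1 : Integrable (fun x => ∑ i, φ i * x.1 i) π := by
        rw [← h1] at hφP
        exact hφP.comp_measurable measurable_fst
      have i2 : Integrable (fun x => ∑ i, φ i * x.2 i) π := by
        have := integrable_empMeasure hn R fun r => ∑ i, φ i * r i
        rw [← h2] at this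
        exact this.comp_measurable measurable_snd
      have key := integral_sub_le_of_coupling hq hpq φ π i1 i2 hs0 hc.le
      have e1 : ∫ r, ∑ i, φ i * r i ∂P = ∫ x, ∑ i, φ i * x.1 i ∂π := by
        rw [← h1, integral_map measurable_fst.aemeasurable hlin.aestronglyMeasurable]
      have e2 : (1 / n : ℝ) * (∑ i, ∑ j, φ j * R i j) = ∫ x, ∑ i, φ i * x.2 i ∂π := by
        rw [← integral_empMeasure R fun r => ∑ j, φ j * r j, ← h2,
          integral_map measurable_snd.aemeasurable hlin.aestronglyMeasurable]
      rwa [e1, e2]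
    have hcont : Continuous fun s : ℝ =>
        (1 / n : ℝ) * (∑ i, ∑ j, φ j * R i j) - Real.sqrt s * _root_.lpNorm p φ := by fun_prop
    exact le_of_tendsto (hcont.continuousWithinAt (s := Set.Ioi δ) (x := δ))
      (eventually_mem_nhdsWithin.mono hbound)
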